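/- In the stationary ergodic environment setting, let β ≥ 0, G ∈ 𝒢, and let λ ∈ ℝ be such that there exist a jointly measurable u : ℝ × Ω → ℝ and a jointly measurable stationary f : ℝ × Ω → ℝ (f(x,ω) = f(0,τ_x ω), f(0,·) bounded) with u(x,ω) = u(0,ω) + ∫₀^x f(z,ω) dz, such that for every ω, u(·,ω) is a Lipschitz viscosity solution of a(x,ω)u'' + G(u') + βV(x,ω) = λ on ℝ. Set θ := 𝔼[f(0,·)]. Then there is an event of probability 1 such that for every ω in it and every globally Lipschitz continuous function u_θ on [0,∞)×ℝ that is a viscosity solution of ∂_t w = a(x,ω)∂²_{xx}w + G(∂_x w) + βV(x,ω) on (0,∞)×ℝ with u_θ(0,x) = θx for all x, one has lim_{t→∞} u_θ(t,0)/t = λ. -/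

import Mathlib

open Real Set MeasureTheory

noncomputable section

/-- The class 𝒢(α₀,α₁,γ): growth condition (G1) and local Lipschitz condition (G2). -/
def MemG (α₀ α₁ γ : ℝ) (G : ℝ → ℝ) : Prop :=
  (∀ p : ℝ, α₀ * |p| ^ γ - 1 / α₀ ≤ G p ∧ G p ≤ α₁ * (|p| ^ γ + 1)) ∧
  (∀ p q : ℝ, |G p - G q| ≤ α₁ * (|p| + |q| + 1) ^ (γ - 1) * |p - q|)

/-- The class 𝒢: union of the classes 𝒢(α₀,α₁,γ). -/
def MemGclass (G : ℝ → ℝ) : Prop :=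
  ∃ α₀ α₁ γ : ℝ, 0 < α₀ ∧ 0 < α₁ ∧ 1 < γ ∧ MemG α₀ α₁ γ G

/-- Condition (G4): strict monotonicity with rate η on both half-lines. -/
def StrictIncrRate (G : ℝ → ℝ) (η : ℝ) : Prop :=
  ∀ p₁ p₂ : ℝ, 0 ≤ p₁ → p₁ < p₂ →
    η * (p₂ - p₁) ≤ G p₂ - G p₁ ∧ η * (p₂ - p₁) ≤ G (-p₂) - G (-p₁)

/-- The class 𝒢_sqc: G ∈ 𝒢, G(0) = 0 and (G4) for some η > 0. -/
def MemGsqc (G : ℝ → ℝ) : Prop :=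
  MemGclass G ∧ G 0 = 0 ∧ ∃ η : ℝ, 0 < η ∧ StrictIncrRate G η

/-- G_+^{-1} : the inverse of the restriction of G to [0,∞). -/
def GplusInv (G : ℝ → ℝ) (y : ℝ) : ℝ := Function.invFunOn G (Set.Ici 0) y

/-- G_−^{-1} : the inverse of the restriction of G to (−∞,0]. -/
def GminusInv (G : ℝ → ℝ) (y : ℝ) : ℝ := Function.invFunOn G (Set.Iic 0) y

/-- Viscosity subsolution of a(x)u'' + G(u') + βV(x) = λ on ℝ. -/
def IsViscSubsol (a V G : ℝ → ℝ) (β lam : ℝ) (u : ℝ → ℝ) : Prop :=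
  ∀ x₀ : ℝ, ∀ φ : ℝ → ℝ, ContDiff ℝ 2 φ →
    IsLocalMax (fun x => u x - φ x) x₀ →
    lam ≤ a x₀ * deriv (deriv φ) x₀ + G (deriv φ x₀) + β * V x₀

/-- Viscosity supersolution of a(x)u'' + G(u') + βV(x) = λ on ℝ. -/
def IsViscSupersol (a V G : ℝ → ℝ) (β lam : ℝ) (u : ℝ → ℝ) : Prop :=
  ∀ x₀ : ℝ, ∀ φ : ℝ → ℝ, ContDiff ℝ 2 φ →
    IsLocalMin (fun x => u x - φ x) x₀ →
    a x₀ * deriv (deriv φ) x₀ + G (deriv φ x₀) + β * V x₀ ≤ lam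

/-- Continuous viscosity solution of a(x)u'' + G(u') + βV(x) = λ on ℝ. -/
def IsViscSol (a V G : ℝ → ℝ) (β lam : ℝ) (u : ℝ → ℝ) : Prop :=
  Continuous u ∧ IsViscSubsol a V G β lam u ∧ IsViscSupersol a V G β lam u

/-- The set 𝒮^λ_+ of Lipschitz viscosity solutions with
u'(x) ∈ [G_+^{-1}(λ−β), G_+^{-1}(λ)] for a.e. x ∈ ℝ. -/
def Splus (a V G : ℝ → ℝ) (β lam : ℝ) : Set (ℝ → ℝ) :=
  {u | (∃ K : NNReal, LipschitzWith K u) ∧ IsViscSol a V G β lam u ∧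
    ∀ᵐ x ∂(volume : Measure ℝ),
      deriv u x ∈ Set.Icc (GplusInv G (lam - β)) (GplusInv G lam)}

/-- The set 𝒮^λ_− of Lipschitz viscosity solutions with
u'(x) ∈ [G_−^{-1}(λ), G_−^{-1}(λ−β)] for a.e. x ∈ ℝ. -/
def Sminus (a V G : ℝ → ℝ) (β lam : ℝ) : Set (ℝ → ℝ) :=
  {u | (∃ K : NNReal, LipschitzWith K u) ∧ IsViscSol a V G β lam u ∧
    ∀ᵐ x ∂(volume : Measure ℝ),
      deriv u x ∈ Set.Icc (GminusInv G lam) (GminusInv G (lam - β))}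

/-- Viscosity solution, continuous on [0,∞)×ℝ, of
∂_t w = a(x) ∂²_xx w + G(∂_x w) + βV(x) on (0,∞)×ℝ. -/
def IsParabolicViscSol (a V G : ℝ → ℝ) (β : ℝ) (w : ℝ → ℝ → ℝ) : Prop :=
  ContinuousOn (fun p : ℝ × ℝ => w p.1 p.2) (Set.Ici 0 ×ˢ Set.univ) ∧
  (∀ t₀ x₀ : ℝ, 0 < t₀ → ∀ φ : ℝ × ℝ → ℝ, ContDiff ℝ 2 φ →
    IsLocalMax (fun p : ℝ × ℝ => w p.1 p.2 - φ p) (t₀, x₀) →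
    deriv (fun t => φ (t, x₀)) t₀ ≤
      a x₀ * deriv (deriv (fun x => φ (t₀, x))) x₀ +
        G (deriv (fun x => φ (t₀, x)) x₀) + β * V x₀) ∧
  (∀ t₀ x₀ : ℝ, 0 < t₀ → ∀ φ : ℝ × ℝ → ℝ, ContDiff ℝ 2 φ →
    IsLocalMin (fun p : ℝ × ℝ => w p.1 p.2 - φ p) (t₀, x₀) →
    a x₀ * deriv (deriv (fun x => φ (t₀, x))) x₀ +
      G (deriv (fun x => φ (t₀, x)) x₀) + β * V x₀ ≤
      deriv (fun t => φ (t, x₀)) t₀)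

/-- A convex function lies below a parabola near any point where its right derivative is
differentiable. -/
lemma ConvexOn.eventually_le_quadratic {F : ℝ → ℝ} (hF : ConvexOn ℝ univ F) {x Y : ℝ}
    (h : HasDerivAt (fun y => derivWithin F (Ioi y) y) Y x) {η : ℝ} (hη : 0 < η) :
    ∀ᶠ k in nhds (0 : ℝ),
      F (x + k) ≤ F x + derivWithin F (Ioi x) x * k + (Y + η) * k ^ 2 / 2 := by
  set g : ℝ → ℝ := fun y => derivWithin F (Ioi y) y with hg
  have hcont : Continuous F := by
    rw [← continuousOn_univ]; exact hF.continuousOn isOpen_univ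
  have hder : ∀ y, HasDerivWithinAt F (g y) (Ici y) y := fun y =>
    (hF.hasDerivWithinAt_rightDeriv_of_mem_interior (by simp)).Ici_of_Ioi
  have hQ : ∀ y, HasDerivAt (fun y => F x + g x * (y - x) + (Y + η) * (y - x) ^ 2 / 2)
      (g x + (Y + η) * (y - x)) y := by
    intro y
    have h1 : HasDerivAt (fun y : ℝ => y - x) 1 y := (hasDerivAt_id y).sub_const x
    exact HasDerivAt.congr_deriv (((h1.const_mul (g x)).const_add (F x)).add
      (((h1.pow 2).const_mul (Y + η)).div_const 2)) (by simp; ring)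
  have hloc := (hasDerivAt_iff_isLittleO.1 h).def hη
  obtain ⟨r, hr, hball⟩ := Metric.eventually_nhds_iff.1 hloc
  rw [Metric.eventually_nhds_iff]
  refine ⟨r, hr, fun k hk => ?_⟩
  rw [Real.dist_eq, sub_zero] at hk
  have key : ∀ y, |y - x| < r → |g y - g x - (y - x) * Y| ≤ η * |y - x| := by
    intro y hy
    have := hball (y := y) (by rwa [Real.dist_eq])
    simpa [Real.norm_eq_abs] using this
  rcases le_total 0 k with h0 | h0
  · have := image_le_of_deriv_right_le_deriv_boundary (f := F) (f' := g) (a := x) (b := x + k)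
      hcont.continuousOn (fun y _ => hder y)
      (B := fun y => F x + g x * (y - x) + (Y + η) * (y - x) ^ 2 / 2)
      (B' := fun y => g x + (Y + η) * (y - x)) (by simp)
      (fun y _ => (hQ y).continuousAt.continuousWithinAt)
      (fun y _ => (hQ y).hasDerivWithinAt) ?_ (right_mem_Icc.2 (by linarith))
    · simpa using this
    · intro y hy
      have hy0 : 0 ≤ y - x := by linarith [hy.1]
      have hk' := abs_lt.1 hk
      have := key y (by rw [abs_of_nonneg hy0]; linarith [hy.2])
      rw [abs_of_nonneg hy0] at this
      linarith [(abs_le.1 this).2]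
  · set Q : ℝ → ℝ := fun y => F x + g x * (y - x) + (Y + η) * (y - x) ^ 2 / 2 with hQdef
    have := image_le_of_deriv_right_le_deriv_boundary (f := fun y => - F y) (f' := fun y => - g y)
      (a := x + k) (b := x)
      hcont.neg.continuousOn (fun y _ => (hder y).neg)
      (B := fun y => - Q y + (Q (x + k) - F (x + k)))
      (B' := fun y => - (g x + (Y + η) * (y - x))) (by simp)
      (fun y _ => ((hQ y).neg.add_const _).continuousAt.continuousWithinAt)
      (fun y _ => ((hQ y).neg.add_const _).hasDerivWithinAt) ?_ (right_mem_Icc.2 (by linarith))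
    · simp [hQdef] at this
      linarith
    · intro y hy
      have hy0 : y - x ≤ 0 := by linarith [hy.2]
      have hk' := abs_lt.1 hk
      have := key y (by rw [abs_of_nonpos hy0]; linarith [hy.1])
      rw [abs_of_nonpos hy0] at this
      linarith [(abs_le.1 this).1]

/-- A one-dimensional form of Jensen's lemma: near a maximum point of the sum of two semiconvex
functions there are points at which both are touched from above by parabolas whose slopes almost
cancel and whose curvatures have almost nonpositive sum. -/
lemma frequently_touching_parabolas {A B : ℝ → ℝ} {C : ℝ} (hC : 0 ≤ C)
    (hA : ConvexOn ℝ univ (fun x => A x + C * x ^ 2 / 2))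
    (hB : ConvexOn ℝ univ (fun x => B x + C * x ^ 2 / 2)) {x₀ : ℝ}
    (hmax : ∀ x, A x + B x ≤ A x₀ + B x₀) {η : ℝ} (hη : 0 < η) :
    ∃ᶠ x in nhds x₀, ∃ p q X Y : ℝ, |p + q| ≤ η ∧ X + Y ≤ η ∧
      (∀ᶠ k in nhds (0 : ℝ), A (x + k) ≤ A x + p * k + X * k ^ 2 / 2) ∧
      (∀ᶠ k in nhds (0 : ℝ), B (x + k) ≤ B x + q * k + Y * k ^ 2 / 2) := by
  set FA : ℝ → ℝ := fun x => A x + C * x ^ 2 / 2 with hFA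
  set FB : ℝ → ℝ := fun x => B x + C * x ^ 2 / 2 with hFB
  set gA : ℝ → ℝ := fun y => derivWithin FA (Ioi y) y with hgA
  set gB : ℝ → ℝ := fun y => derivWithin FB (Ioi y) y with hgB
  have hcA : Continuous FA := by
    rw [← continuousOn_univ]; exact hA.continuousOn isOpen_univ
  have hcB : Continuous FB := by
    rw [← continuousOn_univ]; exact hB.continuousOn isOpen_univ
  have hdA : ∀ y, HasDerivWithinAt FA (gA y) (Ici y) y := fun y =>
    (hA.hasDerivWithinAt_rightDeriv_of_mem_interior (by simp)).Ici_of_Ioi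
  have hdB : ∀ y, HasDerivWithinAt FB (gB y) (Ici y) y := fun y =>
    (hB.hasDerivWithinAt_rightDeriv_of_mem_interior (by simp)).Ici_of_Ioi
  have hmA : Monotone gA := by
    have := hA.monotoneOn_rightDeriv
    rw [interior_univ] at this
    exact monotoneOn_univ.1 this
  have hmB : Monotone gB := by
    have := hB.monotoneOn_rightDeriv
    rw [interior_univ] at this
    exact monotoneOn_univ.1 this
  have sub : ∀ {F g : ℝ → ℝ}, ConvexOn ℝ univ F → (∀ y, HasDerivWithinAt F (g y) (Ici y) y) →
      ∀ x y, x ≤ y → F x + g x * (y - x) ≤ F y := by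
    intro F g hF hd x y hxy
    rcases hxy.eq_or_lt with rfl | hlt
    · simp
    have h1 := hF.le_slope_of_hasDerivWithinAt_Ioi (mem_univ x) (mem_univ y) hlt
      (hd x).Ioi_of_Ici
    rw [slope_def_field, le_div_iff₀ (by linarith)] at h1
    linarith
  set f : ℝ → ℝ := fun x => A x + B x with hf
  have hfe : f = fun x => FA x + FB x - C * x ^ 2 := by
    ext x; simp only [hf, hFA, hFB]; ring
  have hcf : Continuous f := by rw [hfe]; fun_prop
  have hdf : ∀ y, HasDerivWithinAt f (gA y + gB y - 2 * C * y) (Ici y) y := by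
    intro y
    rw [hfe]
    have h1 : HasDerivAt (fun x : ℝ => C * x ^ 2) (2 * C * y) y := by
      exact HasDerivAt.congr_deriv ((hasDerivAt_pow 2 y).const_mul C) (by simp; ring)
    exact ((hdA y).add (hdB y)).sub h1.hasDerivWithinAt
  -- the slope of the sum is small near the maximum point
  have hsub : ∀ x y, f x + (gA x + gB x - 2 * C * x) * (y - x) - C * (y - x) ^ 2 ≤ f y := by
    have hconv : ∀ {F g : ℝ → ℝ}, ConvexOn ℝ univ F →
        (∀ y, HasDerivWithinAt F (g y) (Ici y) y) → Monotone g →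
        (∀ x y, x ≤ y → F x + g x * (y - x) ≤ F y) → Continuous F →
        ∀ x y, F x + g x * (y - x) ≤ F y := by
      intro F g hF hd hm h1 hc x y
      rcases le_total x y with h | h
      · exact h1 x y h
      · have := image_le_of_deriv_right_le_deriv_boundary (f := F) (f' := g)
          (a := y) (b := x) hc.continuousOn (fun y _ => hd y)
          (B := fun z => F y + g x * (z - y)) (B' := fun _ => g x) (by simp)
          (by fun_prop) (fun z _ => by
            simpa using ((((hasDerivAt_id z).sub_const y).const_mul (g x)).const_add
              (F y)).hasDerivWithinAt)
          (fun z hz => hm hz.2.le) (right_mem_Icc.2 h)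
        linarith
    intro x y
    have h1 := hconv hA hdA hmA (sub hA hdA) hcA x y
    have h2 := hconv hB hdB hmB (sub hB hdB) hcB x y
    rw [hfe]
    nlinarith [h1, h2]
  have hslope : ∀ᶠ x in nhds x₀, |gA x + gB x - 2 * C * x| ≤ η := by
    set d : ℝ := η / (2 * (C + 1)) with hd
    have hd0 : 0 < d := by positivity
    have hCd : C * d ≤ η / 2 := by
      rw [hd]; rw [mul_div_assoc', div_le_div_iff₀ (by positivity) (by positivity)]; nlinarith
    have : ∀ᶠ x in nhds x₀, f x₀ - η * d / 2 < f x :=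
      hcf.continuousAt.eventually (lt_mem_nhds (by have : 0 < η * d / 2 := by positivity
                                                   linarith))
    filter_upwards [this] with x hx
    have h1 := hsub x (x + d)
    have h2 := hsub x (x - d)
    have h3 := hmax (x + d)
    have h4 := hmax (x - d)
    have e1 : x + d - x = d := by ring
    have e2 : x - d - x = -d := by ring
    rw [e1] at h1
    rw [e2] at h2
    simp only [hf] at h1 h2 hx
    rw [abs_le]
    constructor <;> nlinarith
  -- the curvature of the sum is frequently almost nonpositive
  have hae : ∀ᵐ x, DifferentiableAt ℝ gA x ∧ DifferentiableAt ℝ gB x := by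
    filter_upwards [hmA.ae_differentiableAt, hmB.ae_differentiableAt] with x h1 h2
    exact ⟨h1, h2⟩
  have hcurv : ∃ᶠ x in nhds x₀, (DifferentiableAt ℝ gA x ∧ DifferentiableAt ℝ gB x) ∧
      deriv gA x + deriv gB x ≤ 2 * C + η / 2 := by
    by_contra hcon
    rw [Filter.not_frequently] at hcon
    obtain ⟨r, hr, hball⟩ := Metric.eventually_nhds_iff.1 hcon
    have hinc : ∀ a b, x₀ - r < a → a ≤ b → b < x₀ + r →
        (2 * C + η / 2) * (b - a) ≤ gA b + gB b - (gA a + gB a) := by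
      intro a b ha hab hb
      have iA := (hmA.monotoneOn (uIcc a b)).intervalIntegrable_deriv
      have iB := (hmB.monotoneOn (uIcc a b)).intervalIntegrable_deriv
      have jA := (hmA.monotoneOn (uIcc a b)).intervalIntegral_deriv_mem_uIcc
      have jB := (hmB.monotoneOn (uIcc a b)).intervalIntegral_deriv_mem_uIcc
      rw [uIcc_of_le (by linarith [hmA hab])] at jA
      rw [uIcc_of_le (by linarith [hmB hab])] at jB
      have hle : ∫ x in a..b, (2 * C + η / 2) ≤ ∫ x in a..b, (deriv gA x + deriv gB x) := by
        apply intervalIntegral.integral_mono_ae_restrict hab (by simp) (iA.add iB)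
        rw [Filter.EventuallyLE, ae_restrict_iff' measurableSet_Icc]
        filter_upwards [hae] with x hx hxab
        have := hball (y := x) (by rw [Real.dist_eq, abs_lt]; constructor <;> linarith [hxab.1, hxab.2])
        push Not at this
        exact (this hx).le
      rw [intervalIntegral.integral_add iA iB, intervalIntegral.integral_const, smul_eq_mul] at hle
      linarith [jA.2, jB.2]
    have hright : gA x₀ + gB x₀ - 2 * C * x₀ ≤ 0 := by
      by_contra hpos
      push Not at hpos
      set s := gA x₀ + gB x₀ - 2 * C * x₀ with hs
      have h1 := hsub x₀ (x₀ + s / (2 * (C + 1)))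
      have h2 := hmax (x₀ + s / (2 * (C + 1)))
      simp only [hf] at h1
      rw [← hs] at h1
      have e1 : x₀ + s / (2 * (C + 1)) - x₀ = s / (2 * (C + 1)) := by ring
      rw [e1] at h1
      have hd0 : 0 < s / (2 * (C + 1)) := by positivity
      have hCd : C * (s / (2 * (C + 1))) ≤ s / 2 := by
        rw [mul_div_assoc', div_le_div_iff₀ (by positivity) (by positivity)]; nlinarith
      nlinarith
    have hB' : ∀ z, HasDerivAt (fun z => f (x₀ - r / 2) + η / 4 * ((x₀ - z) ^ 2 - (r / 2) ^ 2))
        (-(η / 2 * (x₀ - z))) z := by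
      intro z
      exact HasDerivAt.congr_deriv ((((((hasDerivAt_id z).const_sub x₀).pow 2).sub_const ((r / 2) ^ 2)).const_mul
        (η / 4)).const_add (f (x₀ - r / 2))) (by simp; ring)
    have := image_le_of_deriv_right_le_deriv_boundary (f := f)
      (f' := fun y => gA y + gB y - 2 * C * y) (a := x₀ - r / 2) (b := x₀)
      hcf.continuousOn (fun y _ => hdf y)
      (B := fun z => f (x₀ - r / 2) + η / 4 * ((x₀ - z) ^ 2 - (r / 2) ^ 2))
      (B' := fun z => -(η / 2 * (x₀ - z))) (by simp)
      (fun y _ => (hB' y).continuousAt.continuousWithinAt)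
      (fun y _ => (hB' y).hasDerivWithinAt)
      (fun y hy => by
        have := hinc y x₀ (by linarith [hy.1]) hy.2.le (by linarith)
        linarith) (right_mem_Icc.2 (by linarith))
    have h2 := hmax (x₀ - r / 2)
    simp only [hf] at this
    have h3 : 0 < η / 4 * (r / 2) ^ 2 := by positivity
    simp at this
    linarith
  refine (hcurv.and_eventually hslope).mono ?_
  rintro x ⟨⟨⟨h1, h2⟩, h3⟩, h4⟩
  refine ⟨gA x - C * x, gB x - C * x, deriv gA x + η / 4 - C, deriv gB x + η / 4 - C, ?_, ?_, ?_, ?_⟩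
  · convert h4 using 2; ring
  · linarith
  · filter_upwards [hA.eventually_le_quadratic h1.hasDerivAt (η := η / 4) (by positivity)]
      with k hk
    simp only [hFA] at hk
    linarith
  · filter_upwards [hB.eventually_le_quadratic h2.hasDerivAt (η := η / 4) (by positivity)]
      with k hk
    simp only [hFB] at hk
    linarith

/-- Running maximum `max (0, S₁, …, Sₙ)` of the Birkhoff sums of `h` along `T`. -/
def birkhoffMax {Ω : Type*} (T : Ω → Ω) (h : Ω → ℝ) : ℕ → Ω → ℝ
  | 0 => fun _ => 0
  | n + 1 => fun ω => max 0 (h ω + birkhoffMax T h n (T ω))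

/-- Maximal ergodic theorem: if the Birkhoff sums of `h` are almost surely unbounded above then
`h` has nonnegative mean. -/
lemma integral_nonneg_of_birkhoffSum_unbounded {Ω : Type*} [MeasurableSpace Ω] {P : Measure Ω}
    [IsProbabilityMeasure P] {T : Ω → Ω} (hT : MeasurePreserving T P P) {h : Ω → ℝ}
    (hi : Integrable h P) (S : ℕ → Ω → ℝ) (hS0 : ∀ ω, S 0 ω = 0)
    (hS : ∀ n ω, S (n + 1) ω = h ω + S n (T ω))
    (hunb : ∀ᵐ ω ∂P, ∀ C : ℝ, ∃ n, C < S n ω) : 0 ≤ ∫ ω, h ω ∂P := by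
  have hmi : ∀ n, Integrable (birkhoffMax T h n) P := by
    intro n
    induction n with
    | zero => exact integrable_const 0
    | succ n ih => exact (integrable_const (0 : ℝ)).sup (hi.add (hT.integrable_comp_of_integrable ih))
  have hmono : ∀ n ω, birkhoffMax T h n ω ≤ birkhoffMax T h (n + 1) ω := by
    intro n
    induction n with
    | zero => intro ω; exact le_max_left _ _
    | succ n ih => intro ω; exact max_le_max le_rfl (by linarith [ih (T ω)])
  have hle : ∀ n ω, S n ω ≤ birkhoffMax T h n ω := by
    intro n
    induction n with
    | zero => intro ω; rw [hS0]; exact le_rfl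
    | succ n ih =>
      intro ω
      rw [hS]
      exact le_trans (by linarith [ih (T ω)]) (le_max_right _ _)
  have hnn : ∀ n ω, 0 ≤ birkhoffMax T h n ω := by
    intro n ω
    cases n with
    | zero => exact le_rfl
    | succ n => exact le_max_left _ _
  have hdiff : ∀ n ω, birkhoffMax T h (n + 1) ω - birkhoffMax T h n (T ω)
      = max (-birkhoffMax T h n (T ω)) (h ω) := by
    intro n ω
    change max 0 (h ω + birkhoffMax T h n (T ω)) - _ = _
    rw [← max_sub_sub_right]
    congr 1 <;> ring
  have hpos : ∀ n, 0 ≤ ∫ ω, max (-birkhoffMax T h n (T ω)) (h ω) ∂P := by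
    intro n
    have hcomp : Integrable (fun ω => birkhoffMax T h n (T ω)) P :=
      hT.integrable_comp_of_integrable (hmi n)
    simp_rw [← hdiff]
    rw [integral_sub (hmi (n + 1)) hcomp]
    have h1 : ∫ ω, birkhoffMax T h n (T ω) ∂P = ∫ ω, birkhoffMax T h n ω ∂P := by
      have := integral_map hT.measurable.aemeasurable (f := birkhoffMax T h n) (μ := P)
        (by rw [hT.map_eq]; exact (hmi n).aestronglyMeasurable)
      rw [hT.map_eq] at this
      exact this.symm
    rw [h1]
    linarith [integral_mono (hmi n) (hmi (n + 1)) (hmono n)]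
  have hlim : Filter.Tendsto (fun n => ∫ ω, max (-birkhoffMax T h n (T ω)) (h ω) ∂P)
      Filter.atTop (nhds (∫ ω, h ω ∂P)) := by
    apply tendsto_integral_of_dominated_convergence (fun ω => |h ω|)
    · intro n
      exact ((hT.integrable_comp_of_integrable (hmi n)).neg.sup hi).aestronglyMeasurable
    · exact hi.abs
    · intro n
      refine Filter.Eventually.of_forall fun ω => ?_
      rw [Real.norm_eq_abs, abs_le]
      refine ⟨(neg_abs_le _).trans (le_max_right _ _), max_le ?_ (le_abs_self _)⟩
      linarith [hnn n (T ω), abs_nonneg (h ω)]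
    · filter_upwards [hT.quasiMeasurePreserving.ae hunb] with ω hω
      obtain ⟨N, hN⟩ := hω (-h ω)
      apply tendsto_const_nhds.congr'
      filter_upwards [Filter.eventually_ge_atTop N] with n hn
      have : birkhoffMax T h N (T ω) ≤ birkhoffMax T h n (T ω) :=
        monotone_nat_of_le_succ (f := fun n => birkhoffMax T h n (T ω)) (fun n => hmono n _) hn
      rw [max_eq_right]
      linarith [hle N (T ω)]
  exact ge_of_tendsto' hlim hpos

/-- One-sided pointwise ergodic theorem for a bounded observable along an ergodic flow. -/
lemma ae_exists_integral_flow_le {Ω : Type*} [MeasurableSpace Ω] {P : Measure Ω}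
    [IsProbabilityMeasure P] {τ : ℝ → Ω → Ω}
    (hτ_meas : Measurable (fun p : ℝ × Ω => τ p.1 p.2))
    (hτ_zero : ∀ ω, τ 0 ω = ω)
    (hτ_add : ∀ x y : ℝ, ∀ ω, τ (x + y) ω = τ x (τ y ω))
    (hτ_mp : ∀ x : ℝ, MeasurePreserving (τ x) P P)
    (hτ_erg : ∀ g : Ω → ℝ, Measurable g →
      (∀ x : ℝ, ∀ᵐ ω ∂P, g (τ x ω) = g ω) → ∃ c : ℝ, ∀ᵐ ω ∂P, g ω = c)
    {F : Ω → ℝ} (hF : Measurable F) {M : ℝ} (hM : ∀ ω, |F ω| ≤ M)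
    {c : ℝ} (hc : ∫ ω, F ω ∂P < c) :
    ∀ᵐ ω ∂P, ∃ C : ℝ, ∀ x : ℝ, 0 ≤ x → ∫ z in (0 : ℝ)..x, F (τ z ω) ≤ c * x + C := by
  have hFτ : Measurable (fun p : ℝ × Ω => F (τ p.1 p.2)) := hF.comp hτ_meas
  have hFz : ∀ ω, Measurable (fun z => F (τ z ω)) := fun ω =>
    hFτ.comp (measurable_id.prodMk measurable_const)
  have hint : ∀ ω x y, IntervalIntegrable (fun z => F (τ z ω)) volume x y := by
    intro ω x y
    apply (intervalIntegrable_const (c := M)).mono_fun (hFz ω).aestronglyMeasurable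
    exact Filter.Eventually.of_forall fun z => by
      simpa [Real.norm_eq_abs] using (hM (τ z ω)).trans (le_abs_self M)
  set I : ℝ → Ω → ℝ := fun x ω => ∫ z in (0 : ℝ)..x, F (τ z ω) with hI
  have hIdiff : ∀ ω x y, |I y ω - I x ω| ≤ M * |y - x| := by
    intro ω x y
    have : I y ω - I x ω = ∫ z in x..y, F (τ z ω) :=
      intervalIntegral.integral_interval_sub_left (hint _ _ _) (hint _ _ _)
    rw [this, ← Real.norm_eq_abs]
    exact intervalIntegral.norm_integral_le_of_norm_le_const fun z _ => hM _
  have hshift : ∀ x y ω, I x (τ y ω) = I (x + y) ω - I y ω := by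
    intro x y ω
    have h1 : I (x + y) ω - I y ω = ∫ z in y..(x + y), F (τ z ω) :=
      intervalIntegral.integral_interval_sub_left (hint _ _ _) (hint _ _ _)
    rw [h1]
    simp only [hI, ← hτ_add]
    rw [intervalIntegral.integral_comp_add_right (fun z => F (τ z ω)) y, zero_add]
  have hImeas : ∀ n : ℕ, Measurable (I n) := by
    intro n
    have : I n = fun ω => ∫ z in Ioc (0 : ℝ) n, F (τ z ω) := by
      ext ω
      exact intervalIntegral.integral_of_le n.cast_nonneg
    rw [this]
    exact (hFτ.stronglyMeasurable.integral_prod_left'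
      (μ := volume.restrict (Ioc (0 : ℝ) n))).measurable
  have hM0 : 0 ≤ M := by
    by_contra hneg
    have : IsEmpty Ω := ⟨fun ω => hneg ((abs_nonneg _).trans (hM ω))⟩
    have h1 : P univ = 1 := measure_univ
    rw [univ_eq_empty_iff.2 this, measure_empty] at h1
    exact zero_ne_one h1
  set E : Set Ω := {ω | ∃ C : ℕ, ∀ n : ℕ, I n ω ≤ c * n + C} with hE
  have hEmeas : MeasurableSet E := by
    have : E = ⋃ C : ℕ, ⋂ n : ℕ, {ω | I n ω ≤ c * n + C} := by
      ext ω; simp [hE]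
    rw [this]
    exact MeasurableSet.iUnion fun C => MeasurableSet.iInter fun n =>
      measurableSet_le (hImeas n) measurable_const
  have hinv1 : ∀ x ω, ω ∈ E → τ x ω ∈ E := by
    rintro x ω ⟨C, hC⟩
    refine ⟨C + ⌈2 * (M * |x|)⌉₊, fun n => ?_⟩
    rw [hshift]
    have h1 := abs_le.1 (hIdiff ω n (n + x))
    have h2 := abs_le.1 (hIdiff ω 0 x)
    have h3 : I 0 ω = 0 := by simp [hI]
    have h4 := Nat.le_ceil (2 * (M * |x|))
    rw [add_sub_cancel_left] at h1
    rw [sub_zero, h3] at h2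
    push_cast
    linarith [hC n, h1.2, h2.1]
  have hinv : ∀ x ω, τ x ω ∈ E ↔ ω ∈ E := by
    refine fun x ω => ⟨fun h => ?_, hinv1 x ω⟩
    have := hinv1 (-x) _ h
    rwa [← hτ_add, neg_add_cancel, hτ_zero] at this
  obtain ⟨c₀, hc₀⟩ := hτ_erg (E.indicator 1) (measurable_one.indicator hEmeas) (fun x =>
    Filter.Eventually.of_forall fun ω => by
      classical
      simp only [indicator_apply, hinv, Pi.one_apply])
  have hae : ∀ᵐ ω ∂P, ω ∈ E := by
    by_cases h1 : c₀ = 1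
    · filter_upwards [hc₀] with ω hω
      by_contra hn
      rw [indicator_of_notMem hn, h1] at hω
      exact zero_ne_one hω
    · exfalso
      have hnot : ∀ᵐ ω ∂P, ω ∉ E := by
        filter_upwards [hc₀] with ω hω hn
        rw [indicator_of_mem hn] at hω
        exact h1 hω.symm
      have : IsFiniteMeasure (volume.restrict (uIoc (0 : ℝ) 1)) := ⟨by simp [uIoc]⟩
      have hFI : Integrable (Function.uncurry fun (z : ℝ) ω => F (τ z ω))
          ((volume.restrict (uIoc (0 : ℝ) 1)).prod P) := by
        refine (integrable_const M).mono' hFτ.aestronglyMeasurable ?_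
        exact Filter.Eventually.of_forall fun p => hM _
      have hIint : Integrable (I 1) P := by
        refine (integrable_const M).mono' ?_ (Filter.Eventually.of_forall fun ω => ?_)
        · simpa using (hImeas 1).aestronglyMeasurable
        · simpa [hI] using hIdiff ω 0 1
      have hmean : ∫ ω, I 1 ω ∂P = ∫ ω, F ω ∂P := by
        simp only [hI]
        rw [← intervalIntegral_integral_swap hFI]
        have : ∀ z, ∫ ω, F (τ z ω) ∂P = ∫ ω, F ω ∂P := by
          intro z
          have := integral_map (hτ_mp z).measurable.aemeasurable (f := F) (μ := P)
            hF.aestronglyMeasurable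
          rw [(hτ_mp z).map_eq] at this
          exact this.symm
        simp [this]
      have := integral_nonneg_of_birkhoffSum_unbounded (hτ_mp 1) (h := fun ω => I 1 ω - c)
        (hIint.sub (integrable_const c)) (fun n ω => I n ω - c * n)
        (fun ω => by simp [hI]) (fun n ω => by
          rw [hshift]; push_cast; ring) ?_
      · rw [integral_sub hIint (integrable_const c), hmean] at this
        simp at this
        linarith
      · filter_upwards [hnot] with ω hω C
        by_contra hcon
        push Not at hcon
        refine hω ⟨⌈C⌉₊, fun n => ?_⟩
        linarith [hcon n, Nat.le_ceil C]
  filter_upwards [hae] with ω hω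
  obtain ⟨C, hC⟩ := hω
  refine ⟨C + M + |c|, fun x hx => ?_⟩
  have h1 := abs_le.1 (hIdiff ω ⌊x⌋₊ x)
  have h2 := Nat.floor_le hx
  have h3 := Nat.lt_floor_add_one x
  rw [abs_of_nonneg (by linarith)] at h1
  have h4 := hC ⌊x⌋₊
  change I x ω ≤ _
  have h5 : M * (x - ⌊x⌋₊) ≤ M := by nlinarith
  have h6 : c * (⌊x⌋₊ - x) ≤ |c| := by
    have := neg_abs_le c
    nlinarith [abs_nonneg c, le_abs_self c]
  linarith [h1.2]

/-- A function given by upward envelopes of parabolas of opening `-1/e` is semiconvex. -/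
lemma convexOn_of_parabola_envelope {A : ℝ → ℝ} {e : ℝ}
    (h : ∀ x, ∃ z r, A x = r - (x - z) ^ 2 / (2 * e) ∧ ∀ y, r - (y - z) ^ 2 / (2 * e) ≤ A y) :
    ConvexOn ℝ univ (fun x => A x + 1 / e * x ^ 2 / 2) := by
  have hsupp : ∀ x, ∃ s, ∀ y, A x + 1 / e * x ^ 2 / 2 + s * (y - x) ≤ A y + 1 / e * y ^ 2 / 2 := by
    intro x
    obtain ⟨z, r, h1, h2⟩ := h x
    refine ⟨z / e, fun y => ?_⟩
    have h3 := h2 y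
    rw [h1]
    have e1 : r - (x - z) ^ 2 / (2 * e) + 1 / e * x ^ 2 / 2 + z / e * (y - x)
        = r - (y - z) ^ 2 / (2 * e) + 1 / e * y ^ 2 / 2 := by
      by_cases he : e = 0
      · simp [he]
      · field_simp; ring
    linarith
  refine ⟨convex_univ, fun x _ y _ α β hα hβ hαβ => ?_⟩
  obtain ⟨s, hs⟩ := hsupp (α • x + β • y)
  simp only [smul_eq_mul] at hs ⊢
  have h1 := mul_le_mul_of_nonneg_left (hs x) hα
  have h2 := mul_le_mul_of_nonneg_left (hs y) hβ
  have hβ' : β = 1 - α := by linarith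
  subst hβ'
  nlinarith [h1, h2]

lemma eq_zero_of_eventually_nonneg_linear_add_sq {α β : ℝ}
    (h : ∀ᶠ k in nhds (0 : ℝ), 0 ≤ α * k + β * k ^ 2) : α = 0 := by
  have hmin : IsLocalMin (fun k : ℝ => α * k + β * k ^ 2) 0 := by
    filter_upwards [h] with k hk
    simpa using hk
  have hd : HasDerivAt (fun k : ℝ => α * k + β * k ^ 2) α 0 :=
    HasDerivAt.congr_deriv (((hasDerivAt_id (0 : ℝ)).const_mul α).add
      ((hasDerivAt_pow 2 (0 : ℝ)).const_mul β)) (by simp)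
  exact hmin.hasDerivAt_eq_zero hd

/-- A function touched from below by a parabola with vertex `z` has slope `(z - x) / e`. -/
lemma slope_eq_of_parabola_le {A : ℝ → ℝ} {e x z r p X : ℝ}
    (h1 : A x = r - (x - z) ^ 2 / (2 * e)) (h2 : ∀ y, r - (y - z) ^ 2 / (2 * e) ≤ A y)
    (h : ∀ᶠ k in nhds (0 : ℝ), A (x + k) ≤ A x + p * k + X * k ^ 2 / 2) : p = (z - x) / e := by
  have : p - (z - x) / e = 0 := by
    apply eq_zero_of_eventually_nonneg_linear_add_sq (β := (X + 1 / e) / 2)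
    filter_upwards [h] with k hk
    have h3 := h2 (x + k)
    rw [h1] at hk
    have e1 : (x + k - z) ^ 2 / (2 * e)
        = (x - z) ^ 2 / (2 * e) - (z - x) / e * k + 1 / e * k ^ 2 / 2 := by
      by_cases he : e = 0
      · simp [he]
      · field_simp; ring
    rw [e1] at h3
    linarith
  linarith

/-- A smooth function growing like `|x|` with first two derivatives bounded by one. -/
lemma exists_smooth_abs : ∃ ψ : ℝ → ℝ, ContDiff ℝ 2 ψ ∧ (∀ x, |x| ≤ ψ x) ∧
    (∀ x, |deriv ψ x| ≤ 1) ∧ (∀ x, |deriv (deriv ψ) x| ≤ 1) ∧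
    ∀ x y, |ψ x - ψ y| ≤ |x - y| := by
  have hpos : ∀ x : ℝ, 0 < 1 + x ^ 2 := fun x => by positivity
  have hsq : ∀ x : ℝ, √(1 + x ^ 2) ^ 2 = 1 + x ^ 2 := fun x => Real.sq_sqrt (hpos x).le
  have hs0 : ∀ x : ℝ, 0 < √(1 + x ^ 2) := fun x => Real.sqrt_pos.2 (hpos x)
  have hs1 : ∀ x : ℝ, 1 ≤ √(1 + x ^ 2) := fun x => Real.one_le_sqrt.2 (by nlinarith [sq_nonneg x])
  have habs : ∀ x : ℝ, |x| ≤ √(1 + x ^ 2) := fun x => Real.abs_le_sqrt (by linarith)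
  have hd : ∀ x : ℝ, HasDerivAt (fun x : ℝ => √(1 + x ^ 2)) (x / √(1 + x ^ 2)) x := by
    intro x
    refine HasDerivAt.congr_deriv (((hasDerivAt_pow 2 x).const_add 1).sqrt (hpos x).ne') ?_
    have := hs0 x
    field_simp
    simp
  have hdf : deriv (fun x : ℝ => √(1 + x ^ 2)) = fun x => x / √(1 + x ^ 2) :=
    funext fun x => (hd x).deriv
  have hb : ∀ x : ℝ, |deriv (fun x : ℝ => √(1 + x ^ 2)) x| ≤ 1 := by
    intro x
    rw [hdf]
    simp only [abs_div, abs_of_pos (hs0 x)]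
    exact (div_le_one (hs0 x)).2 (habs x)
  refine ⟨fun x => √(1 + x ^ 2), ?_, habs, hb, ?_, ?_⟩
  · exact ContDiff.sqrt (by fun_prop) fun x => (hpos x).ne'
  · intro x
    rw [hdf]
    have h2 : HasDerivAt (fun x : ℝ => x / √(1 + x ^ 2)) (1 / √(1 + x ^ 2) ^ 3) x := by
      refine HasDerivAt.congr_deriv ((hasDerivAt_id x).div (hd x) (hs0 x).ne') ?_
      have h0 := hs0 x
      field_simp
      simp only [id]
      linarith [hsq x]
    rw [h2.deriv, abs_of_nonneg (by have := hs0 x; positivity), div_le_one (pow_pos (hs0 x) 3)]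
    exact one_le_pow₀ (hs1 x)
  · intro x y
    have := Convex.norm_image_sub_le_of_norm_deriv_le (f := fun x : ℝ => √(1 + x ^ 2)) (C := 1)
      (s := univ) (fun x _ => (hd x).differentiableAt) (fun x _ => hb x) convex_univ
      (mem_univ y) (mem_univ x)
    simpa [Real.norm_eq_abs] using this

lemma exists_isMaxOn_of_bounded_superlevel {E : Type*} [NormedAddCommGroup E] [ProperSpace E]
    {s : Set E} (hs : IsClosed s) {h : E → ℝ} (hc : ContinuousOn h s) {p₀ : E} (hp₀ : p₀ ∈ s)
    (R : ℝ) (hR : ∀ p ∈ s, h p₀ ≤ h p → ‖p‖ ≤ R) : ∃ p ∈ s, ∀ q ∈ s, h q ≤ h p := by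
  have hcomp : IsCompact (s ∩ Metric.closedBall 0 R) :=
    (isCompact_closedBall 0 R).inter_left hs
  have hmem : p₀ ∈ s ∩ Metric.closedBall 0 R := ⟨hp₀, by simpa using hR p₀ hp₀ le_rfl⟩
  obtain ⟨p, hp, hmax⟩ := hcomp.exists_isMaxOn ⟨p₀, hmem⟩ (hc.mono inter_subset_left)
  refine ⟨p, hp.1, fun q hq => ?_⟩
  rcases le_total (h p₀) (h q) with hle | hle
  · exact hmax ⟨hq, by simpa using hR q hq hle⟩
  · exact hle.trans (hmax hmem)

/-- Values and derivatives at the base point of a smooth function plus a quadratic. -/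
lemma deriv_add_quadratic {F : ℝ → ℝ} (hF : ContDiff ℝ 2 F) (x c₀ c₁ c₂ : ℝ) :
    ContDiff ℝ 2 (fun z => F z + (c₀ + c₁ * (z - x) + c₂ * (z - x) ^ 2 / 2)) ∧
    deriv (fun z => F z + (c₀ + c₁ * (z - x) + c₂ * (z - x) ^ 2 / 2)) x = deriv F x + c₁ ∧
    deriv (deriv (fun z => F z + (c₀ + c₁ * (z - x) + c₂ * (z - x) ^ 2 / 2))) x
      = deriv (deriv F) x + c₂ := by
  have hsub : ∀ z, HasDerivAt (fun z : ℝ => z - x) 1 z := fun z => (hasDerivAt_id z).sub_const x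
  have hF1 : Differentiable ℝ F := hF.differentiable (by norm_num)
  have hF2 : Differentiable ℝ (deriv F) :=
    (contDiff_succ_iff_deriv.1 (show ContDiff ℝ (1 + 1) F by rwa [one_add_one_eq_two])).2.2.differentiable (by norm_num)
  have h1 : ∀ z, HasDerivAt (fun z => F z + (c₀ + c₁ * (z - x) + c₂ * (z - x) ^ 2 / 2))
      (deriv F z + (c₁ + c₂ * (z - x))) z := fun z =>
    HasDerivAt.congr_deriv ((hF1 z).hasDerivAt.add ((((hsub z).const_mul c₁).const_add c₀).add
      ((((hsub z).pow 2).const_mul c₂).div_const 2))) (by simp; ring)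
  have h2 : deriv (fun z => F z + (c₀ + c₁ * (z - x) + c₂ * (z - x) ^ 2 / 2))
      = fun z => deriv F z + (c₁ + c₂ * (z - x)) := funext fun z => (h1 z).deriv
  refine ⟨by fun_prop, by rw [h2]; simp, ?_⟩
  rw [h2]
  exact (HasDerivAt.congr_deriv ((hF2 x).hasDerivAt.add (((hsub x).const_mul c₂).const_add c₁))
    (by simp)).deriv

/-- `α m - m² / (2e)` is at most `α² e / 2`. -/
lemma mul_sub_sq_div_le {e : ℝ} (he : 0 < e) (α m : ℝ) :
    α * m - m ^ 2 / (2 * e) ≤ α ^ 2 * e / 2 := by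
  have h : α ^ 2 * e / 2 - (α * m - m ^ 2 / (2 * e)) = (m - α * e) ^ 2 / (2 * e) := by
    field_simp; ring
  have : 0 ≤ (m - α * e) ^ 2 / (2 * e) := by positivity
  linarith

lemma abs_le_of_sq_div_le {e : ℝ} (he : 0 < e) {α m : ℝ} (hα : 0 ≤ α)
    (h : m ^ 2 / (2 * e) ≤ α * |m|) : |m| ≤ 2 * e * α := by
  rw [div_le_iff₀ (by positivity), ← sq_abs] at h
  rcases (abs_nonneg m).eq_or_lt with h0 | h0
  · rw [← h0]; positivity
  · nlinarith

/-- If a parabola of opening `-1/e` with vertex `z` touches `A` from below at `x`, and `A` is touched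
from above there by a parabola with data `(p, X)`, then the two combine, along the affine map
`z' ↦ x + c (z' - z)`, to a parabola at `z`. -/
lemma touching_parabola_shift {A : ℝ → ℝ} {e x z r p X : ℝ} (he : 0 < e)
    (h1 : A x = r - (x - z) ^ 2 / (2 * e)) (h2 : ∀ y, r - (y - z) ^ 2 / (2 * e) ≤ A y)
    (h : ∀ᶠ k in nhds (0 : ℝ), A (x + k) ≤ A x + p * k + X * k ^ 2 / 2) (c : ℝ) :
    ∀ᶠ z' in nhds z, A (x + c * (z' - z)) + (x + c * (z' - z) - z') ^ 2 / (2 * e) ≤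
      r + p * (z' - z) + (X * c ^ 2 + (1 - c) ^ 2 / e) * (z' - z) ^ 2 / 2 := by
  have hp := slope_eq_of_parabola_le h1 h2 h
  have ht : Filter.Tendsto (fun z' : ℝ => c * (z' - z)) (nhds z) (nhds 0) := by
    have : Continuous (fun z' : ℝ => c * (z' - z)) := by fun_prop
    simpa using this.tendsto z
  filter_upwards [ht.eventually h] with z' hz'
  rw [h1] at hz'
  have e1 : (x + c * (z' - z) - z') ^ 2 / (2 * e) = (x - z) ^ 2 / (2 * e)
      + (1 - c) * p * (z' - z) + ((1 - c) ^ 2 / e) * (z' - z) ^ 2 / 2 := by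
    rw [hp]; field_simp; ring
  rw [e1]
  linarith

lemma mul_sub_penalty_le {K ν : ℝ} (hν : 0 < ν) (l : ℝ) {t : ℝ} (ht : 0 ≤ t) :
    K * t - (l * t + ν * t ^ 2) ≤ (K + |l|) ^ 2 * (1 / (2 * ν)) / 2 := by
  have h1 := mul_sub_sq_div_le (e := 1 / (2 * ν)) (by positivity) (K + |l|) t
  have e1 : t ^ 2 / (2 * (1 / (2 * ν))) = ν * t ^ 2 := by field_simp
  rw [e1] at h1
  nlinarith [neg_abs_le l]

/-- The penalised sup-convolution of a Lipschitz function on a half plane is attained. -/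
lemma exists_max_penalized {w : ℝ → ℝ → ℝ} {ψ : ℝ → ℝ} {K e δ ν : ℝ} (hK : 0 ≤ K)
    (hw : ∀ t t' x x', 0 ≤ t → 0 ≤ t' → |w t x - w t' x'| ≤ K * (|t - t'| + |x - x'|))
    (hψ : Continuous ψ) (hψlip : ∀ x y, |ψ x - ψ y| ≤ |x - y|)
    (he : 0 < e) (hδ0 : 0 < δ) (hν0 : 0 < ν) (l x : ℝ) :
    ∃ t z, 0 ≤ t ∧ ∀ t' z', 0 ≤ t' →
      w t' z' - (l * t' + ν * t' ^ 2) - δ * ψ z' - (x - z') ^ 2 / (2 * e) ≤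
      w t z - (l * t + ν * t ^ 2) - δ * ψ z - (x - z) ^ 2 / (2 * e) := by
  set pen : ℝ → ℝ := fun t => l * t + ν * t ^ 2 with hpen
  set h : ℝ → ℝ → ℝ → ℝ := fun x t z => w t z - pen t - δ * ψ z - (x - z) ^ 2 / (2 * e) with hh
  have hψx : ∀ x z, -(δ * ψ z) ≤ -(δ * ψ x) + δ * |z - x| := by
    intro x z
    have := abs_le.1 (hψlip z x)
    nlinarith [this.1]
  have hwcont : ContinuousOn (fun p : ℝ × ℝ => w p.1 p.2) (Ici 0 ×ˢ univ) := by
    have : LipschitzOnWith (Real.toNNReal (2 * K)) (fun p : ℝ × ℝ => w p.1 p.2)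
        (Ici 0 ×ˢ univ) := by
      apply LipschitzOnWith.of_dist_le_mul
      rintro ⟨t, x⟩ ⟨ht, -⟩ ⟨t', x'⟩ ⟨ht', -⟩
      rw [Real.dist_eq, Real.coe_toNNReal _ (by positivity), Prod.dist_eq]
      refine (hw t t' x x' ht ht').trans ?_
      simp only [Real.dist_eq]
      nlinarith [le_max_left |t - t'| |x - x'|, le_max_right |t - t'| |x - x'|]
    exact this.continuousOn
  set c₁ : ℝ := (K + |l|) ^ 2 * (1 / (2 * ν)) / 2 with hc₁
  have hcont : ContinuousOn (fun p : ℝ × ℝ => h x p.1 p.2) (Ici 0 ×ˢ univ) := by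
    have h1 : Continuous ψ := hψ
    have h2 : Continuous (fun p : ℝ × ℝ => - pen p.1 - δ * ψ p.2 - (x - p.2) ^ 2 / (2 * e)) := by
      simp only [hpen]; fun_prop
    refine (hwcont.add h2.continuousOn).congr fun p _ => ?_
    simp only [hh, Pi.add_apply]; ring
  set c₂ : ℝ := (K + δ) ^ 2 * e / 2 with hc₂
  have hc₂0 : 0 ≤ c₂ := by positivity
  have hc₁0 : 0 ≤ c₁ := by positivity
  set R₁ : ℝ := 1 + (K + |l| + c₂ + 1) / ν with hR₁
  set R₂ : ℝ := 1 + 2 * e * (K + δ + c₁ + 1) with hR₂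
  have hbdd : ∀ p ∈ Ici (0 : ℝ) ×ˢ (univ : Set ℝ), h x 0 x ≤ h x p.1 p.2 →
      ‖p‖ ≤ max R₁ (R₂ + |x|) := by
    rintro ⟨t, z⟩ ⟨ht, -⟩ hle
    have ht0 : 0 ≤ t := ht
    have h1 := (abs_le.1 (hw t 0 z x ht le_rfl)).2
    rw [sub_zero, abs_of_nonneg ht0] at h1
    have h2 := hψx x z
    have h3 : pen 0 = 0 := by simp [hpen]
    simp only [hh, h3, sub_self, sub_zero, zero_pow two_ne_zero, zero_div] at hle
    have e2 : (x - z) ^ 2 = |z - x| ^ 2 := by rw [sq_abs]; ring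
    rw [e2] at hle
    have h4 := mul_sub_sq_div_le he (K + δ) |z - x|
    have h5 : K * t - pen t ≤ c₁ := mul_sub_penalty_le hν0 l ht0
    have hle' : 0 ≤ (K * t - pen t) + ((K + δ) * |z - x| - |z - x| ^ 2 / (2 * e)) := by
      linarith
    rw [Prod.norm_def]
    refine max_le_max ?_ ?_
    · rw [Real.norm_eq_abs, abs_of_nonneg ht0]
      by_contra hc
      push Not at hc
      have hR₁' : ν * (R₁ - 1) = K + |l| + c₂ + 1 := by
        rw [hR₁]; field_simp; ring
      have h1R : 1 ≤ R₁ := by rw [hR₁]; linarith [show 0 ≤ (K + |l| + c₂ + 1) / ν by positivity]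
      have h6 : K * t - pen t + c₂ < 0 := by
        have := neg_abs_le (l)
        have h7 : K + |l| + c₂ + 1 ≤ ν * t := by
          rw [← hR₁']
          exact mul_le_mul_of_nonneg_left (by linarith only [hc]) hν0.le
        have h8 := mul_le_mul_of_nonneg_right h7 ht0
        have h10 : c₂ * 1 ≤ c₂ * t := mul_le_mul_of_nonneg_left (by linarith only [h1R, hc]) hc₂0
        have h11 := mul_le_mul_of_nonneg_right this ht0
        simp only [hpen]
        linarith only [h8, h10, h11, h1R, hc]
      linarith only [hle', h4, h6, hc₂]
    · rw [Real.norm_eq_abs]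
      have h9 : |z| ≤ |z - x| + |x| := by
        have := abs_add_le (z - x) x
        simpa using this
      suffices |z - x| ≤ R₂ by linarith
      by_contra hc
      push Not at hc
      set m := |z - x| with hm
      have h1R : 1 ≤ R₂ := by rw [hR₂]; linarith [show 0 ≤ 2 * e * (K + δ + c₁ + 1) by positivity]
      have h6 : (K + δ) * m - m ^ 2 / (2 * e) + c₁ < 0 := by
        have h7 : (K + δ + c₁ + 1) * m ≤ m ^ 2 / (2 * e) := by
          rw [le_div_iff₀ (by positivity)]
          have h10 : 2 * e * (K + δ + c₁ + 1) ≤ m := by linarith only [hR₂, hc]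
          have h11 := mul_le_mul_of_nonneg_right h10 (abs_nonneg (z - x))
          linarith only [h11]
        have h12 : c₁ * 1 ≤ c₁ * m := mul_le_mul_of_nonneg_left (by linarith only [h1R, hc]) hc₁0
        linarith only [h7, h12, h1R, hc]
      linarith only [hle', h5, h6]
  obtain ⟨⟨t, z⟩, ⟨ht, -⟩, hmax⟩ := exists_isMaxOn_of_bounded_superlevel
    (isClosed_Ici.prod isClosed_univ) hcont (p₀ := ((0 : ℝ), x)) ⟨self_mem_Ici, mem_univ _⟩ _ hbdd
  exact ⟨t, z, ht, fun t' z' ht' => hmax (t', z') ⟨ht', mem_univ _⟩⟩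

/-- The inequality obtained by subtracting the tests for the sub- and supersolution, with the
interpolation weights chosen so that the curvature terms cancel. -/
lemma doubled_inequality_absurd {s b G : ℝ → ℝ} {κ κb M e lam ε δ ψ₁ ψ₂ p q X Y z y : ℝ}
    (hs0 : ∀ x, 0 ≤ s x) (hs1 : ∀ x, s x ≤ 1) (hκ : 0 ≤ κ)
    (hs : ∀ x y, |s x - s y| ≤ κ * |x - y|) (hκb : 0 ≤ κb)
    (hb : ∀ x y, |b x - b y| ≤ κb * |x - y|) (he : 0 < e) (hε : 0 < ε)
    (hδ0 : 0 < δ) (hδε : δ ≤ ε / 16) (hψ2 : |ψ₂| ≤ 1)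
    (heε : κ ^ 2 * M ^ 2 * e + κb * M * e ≤ ε / 16)
    (hXY : X + Y ≤ δ) (hzy : |z - y| ≤ e * M)
    (hGdiff : G (δ * ψ₁ + p) - G (-q) ≤ ε / 16)
    (hsub : ∀ c, lam + ε / 2 ≤ s z ^ 2 * (δ * ψ₂ + (X * c ^ 2 + (1 - c) ^ 2 / e))
      + G (δ * ψ₁ + p) + b z)
    (hsup : ∀ c, s y ^ 2 * (-(Y * c ^ 2 + (1 - c) ^ 2 / e)) + G (-q) + b y ≤ lam) :
    False := by
  set m := min (s z) (s y) with hm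
  have hm0 : 0 ≤ m := le_min (hs0 z) (hs0 y)
  have hm1 : m ≤ 1 := (min_le_left _ _).trans (hs1 z)
  have hcz : s z * (m / s z) = m := by
    rcases (hs0 z).eq_or_lt with h0 | h0
    · have : m ≤ s z := min_le_left _ _
      rw [← h0]; linarith [zero_mul (m / 0)]
    · field_simp
  have hcy : s y * (m / s y) = m := by
    rcases (hs0 y).eq_or_lt with h0 | h0
    · have : m ≤ s y := min_le_right _ _
      rw [← h0]; linarith [zero_mul (m / 0)]
    · field_simp
  set c := m / s z with hc
  set c' := m / s y with hc'
  have ineq1 := hsub c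
  have ineq2 := hsup c'
  have hbdiff : b z - b y ≤ κb * M * e := by
    have h1 := (le_abs_self _).trans (hb z y)
    have h2 := mul_le_mul_of_nonneg_left hzy hκb
    linarith
  have hsdiff : (s z - s y) ^ 2 / e ≤ κ ^ 2 * M ^ 2 * e := by
    rw [div_le_iff₀ he, ← sq_abs]
    have h1 := (hs z y).trans (mul_le_mul_of_nonneg_left hzy hκ)
    calc |s z - s y| ^ 2 ≤ (κ * (e * M)) ^ 2 := pow_le_pow_left₀ (abs_nonneg _) h1 2
      _ = κ ^ 2 * M ^ 2 * e * e := by ring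
  have hmin : (s z - m) ^ 2 + (s y - m) ^ 2 = (s z - s y) ^ 2 := by
    rcases le_total (s z) (s y) with h1 | h1
    · rw [hm, min_eq_left h1]; ring
    · rw [hm, min_eq_right h1]; ring
  have hz2 : s z ^ 2 * (X * c ^ 2 + (1 - c) ^ 2 / e) = X * m ^ 2 + (s z - m) ^ 2 / e := by
    rw [← hcz]; ring
  have hy2 : s y ^ 2 * (-(Y * c' ^ 2 + (1 - c') ^ 2 / e)) = -(Y * m ^ 2) - (s y - m) ^ 2 / e := by
    rw [← hcy]; ring
  have hcurv : s z ^ 2 * (δ * ψ₂) ≤ δ := by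
    calc s z ^ 2 * (δ * ψ₂) ≤ s z ^ 2 * δ := by
          have := mul_le_of_le_one_right hδ0.le (abs_le.1 hψ2).2
          gcongr
      _ ≤ δ := mul_le_of_le_one_left hδ0.le (pow_le_one₀ (hs0 z) (hs1 z))
  have hXYm : (X + Y) * m ^ 2 ≤ δ := by
    calc (X + Y) * m ^ 2 ≤ δ * m ^ 2 := mul_le_mul_of_nonneg_right hXY (sq_nonneg m)
      _ ≤ δ := mul_le_of_le_one_right hδ0.le (pow_le_one₀ hm0 hm1)
  have hsplit : (s z - m) ^ 2 / e + (s y - m) ^ 2 / e = (s z - s y) ^ 2 / e := by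
    rw [← hmin]; ring
  rw [mul_add, hz2] at ineq1
  rw [hy2] at ineq2
  rw [add_mul] at hXYm
  generalize (s z - m) ^ 2 / e = r₁ at *
  generalize (s y - m) ^ 2 / e = r₂ at *
  generalize (s z - s y) ^ 2 / e = r₃ at *
  linarith only [ineq1, ineq2, hcurv, hXYm, hsplit, hsdiff, hbdiff, hGdiff, heε, hδε, hε]

/-- One-sided comparison between a subsolution of the evolution problem with linear initial datum
and a supersolution of the stationary problem with sublinear deviation from that datum. -/
lemma subsolution_le_of_corrector {s b G u : ℝ → ℝ} {w : ℝ → ℝ → ℝ} {κ κb K L lam θ : ℝ}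
    (hs0 : ∀ x, 0 ≤ s x) (hs1 : ∀ x, s x ≤ 1) (hκ : 0 ≤ κ)
    (hs : ∀ x y, |s x - s y| ≤ κ * |x - y|) (hκb : 0 ≤ κb)
    (hb : ∀ x y, |b x - b y| ≤ κb * |x - y|) (hG : Continuous G)
    (hL : 0 ≤ L) (hu : ∀ x y, |u x - u y| ≤ L * |x - y|)
    (husup : ∀ x₀ φ, ContDiff ℝ 2 φ → IsLocalMin (fun x => u x - φ x) x₀ →
      s x₀ ^ 2 * deriv (deriv φ) x₀ + G (deriv φ x₀) + b x₀ ≤ lam)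
    (hK : 0 ≤ K) (hw : ∀ t t' x x', 0 ≤ t → 0 ≤ t' →
      |w t x - w t' x'| ≤ K * (|t - t'| + |x - x'|))
    (hwsub : ∀ t₀ x₀ : ℝ, 0 < t₀ → ∀ ξ χ : ℝ → ℝ, ContDiff ℝ 2 ξ → ContDiff ℝ 2 χ →
      IsLocalMax (fun p : ℝ × ℝ => w p.1 p.2 - (ξ p.1 + χ p.2)) (t₀, x₀) →
      deriv ξ t₀ ≤ s x₀ ^ 2 * deriv (deriv χ) x₀ + G (deriv χ x₀) + b x₀)
    (hw0 : ∀ x, w 0 x = θ * x)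
    (hgrow : ∀ δ : ℝ, 0 < δ → ∃ C, ∀ x, θ * x - u x ≤ δ * |x| + C)
    {ε : ℝ} (hε : 0 < ε) : ∃ C, ∀ T, 0 < T → w T 0 ≤ (lam + ε) * T + C := by
  obtain ⟨ψ, hψ, hψabs, hψ1, hψ2, hψlip⟩ := exists_smooth_abs
  obtain ⟨ρ, hρ, hGρ⟩ : ∃ ρ > 0, ∀ p ∈ Icc (-(2 * K + 2 * L + 4)) (2 * K + 2 * L + 4),
      ∀ q ∈ Icc (-(2 * K + 2 * L + 4)) (2 * K + 2 * L + 4), |p - q| < ρ →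
      |G p - G q| ≤ ε / 16 := by
    have := (isCompact_Icc (a := -(2 * K + 2 * L + 4)) (b := 2 * K + 2 * L + 4)).uniformContinuousOn_of_continuous
      hG.continuousOn
    obtain ⟨ρ, hρ, h⟩ := Metric.uniformContinuousOn_iff.1 this (ε / 16) (by positivity)
    exact ⟨ρ, hρ, fun p hp q hq hpq => (h p hp q hq hpq).le⟩
  obtain ⟨δ, hδ0, hδ1, hδρ, hδε⟩ : ∃ δ : ℝ, 0 < δ ∧ δ ≤ 1 ∧ 2 * δ < ρ ∧ δ ≤ ε / 16 := by
    refine ⟨min 1 (min (ρ / 4) (ε / 16)), by positivity, min_le_left _ _, ?_, ?_⟩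
    · have : min 1 (min (ρ / 4) (ε / 16)) ≤ ρ / 4 := (min_le_right _ _).trans (min_le_left _ _)
      linarith
    · exact (min_le_right _ _).trans (min_le_right _ _)
  set M : ℝ := 2 * K + 2 * L + 2 with hMdef
  have hM0 : 0 < M := by positivity
  set e : ℝ := ε / (16 * (κ ^ 2 * M ^ 2 + κb * M + 1)) with hedef
  have he : 0 < e := by positivity
  have heε : κ ^ 2 * M ^ 2 * e + κb * M * e ≤ ε / 16 := by
    have : (κ ^ 2 * M ^ 2 + κb * M + 1) * e = ε / 16 := by
      rw [hedef]; field_simp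
    nlinarith
  obtain ⟨C₁, hC₁⟩ := hgrow (δ / 2) (by positivity)
  set C₀ : ℝ := C₁ + L ^ 2 * e with hC₀
  refine ⟨C₀ + u 0 + δ * ψ 0, fun T hT => ?_⟩
  by_contra hcon
  push Not at hcon
  set ν : ℝ := ε / (2 * T) with hν
  have hν0 : 0 < ν := by positivity
  set pen : ℝ → ℝ := fun t => (lam + ε / 2) * t + ν * t ^ 2 with hpen
  have hpenT : pen T = (lam + ε) * T := by
    simp only [hpen, hν]; field_simp; ring
  have hpend : ∀ t, HasDerivAt pen (lam + ε / 2 + 2 * ν * t) t := fun t =>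
    HasDerivAt.congr_deriv (((hasDerivAt_id t).const_mul (lam + ε / 2)).add
      ((hasDerivAt_pow 2 t).const_mul ν)) (by simp; ring)
  -- growth of the penalised time variable
  set c₁ : ℝ := (K + |lam + ε / 2|) ^ 2 * (1 / (2 * ν)) / 2 with hc₁
  have htime : ∀ t, 0 ≤ t → K * t - pen t ≤ c₁ :=
    fun t ht => mul_sub_penalty_le hν0 (lam + ε / 2) ht
  -- the sup-convolution of the subsolution
  set h : ℝ → ℝ → ℝ → ℝ := fun x t z => w t z - pen t - δ * ψ z - (x - z) ^ 2 / (2 * e) with hh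
  have hψx : ∀ x z, -(δ * ψ z) ≤ -(δ * ψ x) + δ * |z - x| := by
    intro x z
    have := abs_le.1 (hψlip z x)
    nlinarith [this.1]
  have hAex := exists_max_penalized hK hw hψ.continuous hψlip he hδ0 hν0 (lam + ε / 2)
  choose tA zA htA hAmax using hAex
  change ∀ x t' z', 0 ≤ t' → h x t' z' ≤ h x (tA x) (zA x) at hAmax
  set A : ℝ → ℝ := fun x => h x (tA x) (zA x) with hA
  have hAge : ∀ x t z, 0 ≤ t → w t z - pen t - δ * ψ z - (x - z) ^ 2 / (2 * e) ≤ A x :=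
    fun x t z ht => hAmax x t z ht
  -- the sup-convolution of the negated supersolution
  set h' : ℝ → ℝ → ℝ := fun x y => - u y - (x - y) ^ 2 / (2 * e) with hh'
  have hucont : Continuous u := by
    have : LipschitzWith (Real.toNNReal L) u := by
      apply LipschitzWith.of_dist_le_mul
      intro x y
      rw [Real.dist_eq, Real.dist_eq, Real.coe_toNNReal _ hL]
      exact hu x y
    exact this.continuous
  have hBex : ∀ x, ∃ y, ∀ y', h' x y' ≤ h' x y := by
    intro x
    have hcont : Continuous (h' x) := by simp only [hh']; fun_prop
    obtain ⟨y, -, hmax⟩ := exists_isMaxOn_of_bounded_superlevel isClosed_univ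
      hcont.continuousOn (mem_univ x) (2 * e * L + |x|) (by
        intro y _ hle
        simp only [hh', sub_self] at hle
        have h1 := (abs_le.1 (hu y x)).1
        have h2 : |x - y| ≤ 2 * e * L := by
          apply abs_le_of_sq_div_le he hL
          rw [abs_sub_comm]
          simp at hle
          linarith
        rw [abs_sub_comm] at h2
        have := abs_add_le (y - x) x
        rw [sub_add_cancel] at this
        rw [Real.norm_eq_abs]
        linarith)
    exact ⟨y, fun y' => hmax y' (mem_univ _)⟩
  choose yB hBmax using hBex
  set B : ℝ → ℝ := fun x => h' x (yB x) with hB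
  have hBge : ∀ x y, - u y - (x - y) ^ 2 / (2 * e) ≤ B x := fun x y => hBmax x y
  -- distances between maximizers
  have hdA : ∀ x, |x - zA x| ≤ 2 * e * (K + δ) := by
    intro x
    apply abs_le_of_sq_div_le he (by positivity)
    have h1 := hAge x (tA x) x (htA x)
    simp only [hA, hh, sub_self] at h1
    have h2 := (abs_le.1 (hw (tA x) (tA x) (zA x) x (htA x) (htA x))).2
    have h3 := hψx x (zA x)
    rw [sub_self, abs_zero, zero_add] at h2
    rw [abs_sub_comm x]
    simp at h1
    linarith
  have hdB : ∀ x, |x - yB x| ≤ 2 * e * L := by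
    intro x
    apply abs_le_of_sq_div_le he hL
    have h1 := hBge x x
    simp only [hB, hh', sub_self] at h1
    have h2 := (abs_le.1 (hu (yB x) x)).1
    rw [abs_sub_comm x]
    simp at h1
    linarith
  -- upper bounds on the sum
  have hspace : ∀ x z y, θ * z - δ * ψ z - (x - z) ^ 2 / (2 * e) + (- u y - (x - y) ^ 2 / (2 * e))
      ≤ C₀ - δ / 2 * |z| := by
    intro x z y
    have h1 := hC₁ z
    have h2 := (abs_le.1 (hu z y)).2
    have h3 : |z - y| ≤ |x - z| + |x - y| := by
      have := abs_sub_le z x y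
      rwa [abs_sub_comm z x] at this
    have h4 := mul_sub_sq_div_le he L |x - z|
    have h5 := mul_sub_sq_div_le he L |x - y|
    rw [sq_abs] at h4 h5
    have h6 := mul_le_mul_of_nonneg_left (hψabs z) hδ0.le
    have h7 := mul_le_mul_of_nonneg_left h3 hL
    simp only [hC₀]
    linarith
  have hsum : ∀ x, A x + B x ≤ c₁ + C₀ - δ / 2 * |zA x| := by
    intro x
    have h1 := hspace x (zA x) (yB x)
    have h2 : K * tA x - pen (tA x) ≤ c₁ := htime (tA x) (htA x)
    have h3 := (abs_le.1 (hw (tA x) 0 (zA x) (zA x) (htA x) le_rfl)).2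
    rw [hw0, sub_zero, sub_self, abs_zero, add_zero, abs_of_nonneg (htA x)] at h3
    simp only [hA, hh, hB, hh']
    linarith
  have hsum0 : ∀ x, tA x = 0 → A x + B x ≤ C₀ := by
    intro x hx
    have h1 := hspace x (zA x) (yB x)
    have h2 : 0 ≤ δ / 2 * |zA x| := by positivity
    simp only [hA, hh, hB, hh', hx, hw0]
    have h3 : pen 0 = 0 := by simp [hpen]
    rw [h3]
    linarith
  have hAconv : ConvexOn ℝ univ (fun x => A x + 1 / e * x ^ 2 / 2) :=
    convexOn_of_parabola_envelope fun x => ⟨zA x, w (tA x) (zA x) - pen (tA x) - δ * ψ (zA x), rfl,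
      fun y => hAge y (tA x) (zA x) (htA x)⟩
  have hBconv : ConvexOn ℝ univ (fun x => B x + 1 / e * x ^ 2 / 2) :=
    convexOn_of_parabola_envelope fun x => ⟨yB x, - u (yB x), rfl, fun y => hBge y (yB x)⟩
  have hfcont : Continuous (fun x => A x + B x) := by
    have h1 : Continuous (fun x => A x + 1 / e * x ^ 2 / 2) := by
      rw [← continuousOn_univ]; exact hAconv.continuousOn isOpen_univ
    have h2 : Continuous (fun x => B x + 1 / e * x ^ 2 / 2) := by
      rw [← continuousOn_univ]; exact hBconv.continuousOn isOpen_univ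
    have h3 : (fun x => A x + B x) = fun x =>
        (A x + 1 / e * x ^ 2 / 2) + (B x + 1 / e * x ^ 2 / 2) - 1 / e * x ^ 2 := by
      ext x; ring
    rw [h3]; fun_prop
  have hf0 : C₀ < A 0 + B 0 := by
    have h1 := hAge 0 T 0 hT.le
    have h2 := hBge 0 0
    rw [hpenT] at h1
    simp at h1 h2
    linarith
  obtain ⟨x₀, -, hx₀⟩ := exists_isMaxOn_of_bounded_superlevel isClosed_univ
    hfcont.continuousOn (mem_univ 0) (2 * e * (K + δ) + 2 * c₁ / δ) (by
      intro x _ hx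
      have h1 := hsum x
      have h2 := hdA x
      have h3 : |x| ≤ |x - zA x| + |zA x| := by
        simpa using abs_add_le (x - zA x) (zA x)
      have h4 : |zA x| ≤ 2 * c₁ / δ := by
        rw [le_div_iff₀ hδ0]; linarith
      rw [Real.norm_eq_abs]
      linarith)
  have hjensen := frequently_touching_parabolas (by positivity) hAconv hBconv
    (fun x => hx₀ x (mem_univ x)) hδ0
  have hnear : ∀ᶠ x in nhds x₀, C₀ < A x + B x :=
    hfcont.continuousAt.eventually (lt_mem_nhds (hf0.trans_le (hx₀ 0 (mem_univ 0))))
  obtain ⟨x, ⟨p, q, X, Y, hpq, hXY, hAtouch, hBtouch⟩, hx⟩ := (hjensen.and_eventually hnear).exists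
  have ht : 0 < tA x := (htA x).lt_of_ne fun h0 => (hsum0 x h0.symm).not_gt hx
  have hAx : A x = (w (tA x) (zA x) - pen (tA x) - δ * ψ (zA x)) - (x - zA x) ^ 2 / (2 * e) := rfl
  have hBx : B x = - u (yB x) - (x - yB x) ^ 2 / (2 * e) := rfl
  set t := tA x with htdef
  set z := zA x with hzdef
  set y := yB x with hydef
  have hAsupp : ∀ x', (w t z - pen t - δ * ψ z) - (x' - z) ^ 2 / (2 * e) ≤ A x' :=
    fun x' => hAge x' t z ht.le
  have hBsupp : ∀ x', - u y - (x' - y) ^ 2 / (2 * e) ≤ B x' := fun x' => hBge x' y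
  have hp := slope_eq_of_parabola_le hAx hAsupp hAtouch
  have hq := slope_eq_of_parabola_le hBx hBsupp hBtouch
  -- testing the subsolution
  have ineq1 : ∀ c, lam + ε / 2 ≤ s z ^ 2 * (δ * deriv (deriv ψ) z + (X * c ^ 2 + (1 - c) ^ 2 / e))
      + G (δ * deriv ψ z + p) + b z := by
    intro c
    obtain ⟨hχ, hχ1, hχ2⟩ := deriv_add_quadratic (F := fun z => δ * ψ z) (by fun_prop) z
      (w t z - pen t - δ * ψ z) p (X * c ^ 2 + (1 - c) ^ 2 / e)
    have hψd : Differentiable ℝ ψ := hψ.differentiable (by norm_num)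
    have e1 : deriv (fun z => δ * ψ z) = fun z => δ * deriv ψ z := by
      ext z; exact deriv_const_mul _ (hψd z)
    have e2 : deriv (fun z => δ * deriv ψ z) z = δ * deriv (deriv ψ) z := by
      exact deriv_const_mul_field _
    have := hwsub t z ht pen _ (by simp only [hpen]; fun_prop) hχ ?_
    · rw [hχ1, hχ2, e1, e2, (hpend t).deriv] at this
      have h0 : 0 < 2 * ν * t := by positivity
      linarith
    · have hsh := touching_parabola_shift he hAx hAsupp hAtouch c
      have ev1 : ∀ᶠ P : ℝ × ℝ in nhds (t, z), 0 ≤ P.1 :=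
        continuous_fst.continuousAt.eventually (le_mem_nhds ht)
      have ev2 := (continuous_snd.tendsto ((t, z) : ℝ × ℝ)).eventually hsh
      filter_upwards [ev1, ev2] with P hP1 hP2
      have := hAge (x + c * (P.2 - z)) P.1 P.2 hP1
      simp
      linarith
  -- testing the supersolution
  have ineq2 : ∀ c', s y ^ 2 * (-(Y * c' ^ 2 + (1 - c') ^ 2 / e)) + G (-q) + b y ≤ lam := by
    intro c'
    obtain ⟨hχ, hχ1, hχ2⟩ := deriv_add_quadratic (F := fun _ => 0) (by fun_prop) y
      (u y) (-q) (-(Y * c' ^ 2 + (1 - c') ^ 2 / e))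
    have := husup y _ hχ ?_
    · rw [hχ1, hχ2] at this
      simpa using this
    · have hsh := touching_parabola_shift he hBx hBsupp hBtouch c'
      filter_upwards [hsh] with y' hy'
      have := hBge (x + c' * (y' - y)) y'
      simp
      linarith
  have hδψ : |δ * deriv ψ z| ≤ δ := by
    rw [abs_mul, abs_of_pos hδ0]
    exact mul_le_of_le_one_right hδ0.le (hψ1 z)
  have hpb : |p| ≤ 2 * (K + δ) := by
    rw [hp, abs_div, abs_of_pos he, div_le_iff₀ he, abs_sub_comm]
    linarith [hdA x]
  have hqb : |q| ≤ 2 * L := by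
    rw [hq, abs_div, abs_of_pos he, div_le_iff₀ he, abs_sub_comm]
    linarith [hdB x]
  have hGdiff : G (δ * deriv ψ z + p) - G (-q) ≤ ε / 16 := by
    have h1 := abs_le.1 hδψ
    have h2 := abs_le.1 hpb
    have h3 := abs_le.1 hqb
    have h4 := abs_le.1 hpq
    refine (le_abs_self _).trans (hGρ _ ⟨?_, ?_⟩ _ ⟨?_, ?_⟩ ?_)
    · linarith
    · linarith
    · linarith
    · linarith
    · refine lt_of_le_of_lt ?_ hδρ
      rw [abs_le]; constructor <;> linarith
  have hzy : |z - y| ≤ e * M := by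
    have h1 := abs_sub_le z x y
    rw [abs_sub_comm z x] at h1
    have h2 := hdA x
    have h3 := hdB x
    have h4 : e * M = 2 * e * (K + δ) + 2 * e * L + 2 * e * (1 - δ) := by rw [hMdef]; ring
    have h5 : 0 ≤ 2 * e * (1 - δ) := mul_nonneg (by positivity) (sub_nonneg.2 hδ1)
    rw [h4]
    linarith only [h1, h2, h3, h5]
  exact doubled_inequality_absurd hs0 hs1 hκ hs hκb hb he hε hδ0 hδε (hψ2 z) heε hXY hzy hGdiff
    ineq1 ineq2

/-- Forward sublinearity of the centred primitive of a bounded observable along an ergodic flow. -/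
lemma ae_abs_integral_flow_sub_le_of_nonneg {Ω : Type*} [MeasurableSpace Ω] {P : Measure Ω}
    [IsProbabilityMeasure P] {τ : ℝ → Ω → Ω}
    (hτ_meas : Measurable (fun p : ℝ × Ω => τ p.1 p.2))
    (hτ_zero : ∀ ω, τ 0 ω = ω)
    (hτ_add : ∀ x y : ℝ, ∀ ω, τ (x + y) ω = τ x (τ y ω))
    (hτ_mp : ∀ x : ℝ, MeasurePreserving (τ x) P P)
    (hτ_erg : ∀ g : Ω → ℝ, Measurable g →
      (∀ x : ℝ, ∀ᵐ ω ∂P, g (τ x ω) = g ω) → ∃ c : ℝ, ∀ᵐ ω ∂P, g ω = c)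
    {F : Ω → ℝ} (hF : Measurable F) {M : ℝ} (hM : ∀ ω, |F ω| ≤ M) {δ : ℝ} (hδ : 0 < δ) :
    ∀ᵐ ω ∂P, ∃ C : ℝ, ∀ x : ℝ, 0 ≤ x →
      |(∫ z in (0 : ℝ)..x, F (τ z ω)) - (∫ ω, F ω ∂P) * x| ≤ δ * x + C := by
  have h1 := ae_exists_integral_flow_le hτ_meas hτ_zero hτ_add hτ_mp hτ_erg hF hM
    (c := (∫ ω, F ω ∂P) + δ) (by linarith)
  have h2 := ae_exists_integral_flow_le hτ_meas hτ_zero hτ_add hτ_mp hτ_erg hF.neg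
    (M := M) (by simpa using hM) (c := -(∫ ω, F ω ∂P) + δ)
    (by simp only [Pi.neg_apply, integral_neg]; linarith)
  filter_upwards [h1, h2] with ω ⟨C₁, hC₁⟩ ⟨C₂, hC₂⟩
  refine ⟨max C₁ C₂, fun x hx => ?_⟩
  have h3 := hC₁ x hx
  have h4 := hC₂ x hx
  simp only [Pi.neg_apply, intervalIntegral.integral_neg] at h4
  rw [abs_le]
  constructor
  · linarith [le_max_right C₁ C₂]
  · linarith [le_max_left C₁ C₂]

/-- Two-sided sublinearity of the centred primitive of a bounded observable along an ergodic flow. -/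
lemma ae_abs_integral_flow_sub_le {Ω : Type*} [MeasurableSpace Ω] {P : Measure Ω}
    [IsProbabilityMeasure P] {τ : ℝ → Ω → Ω}
    (hτ_meas : Measurable (fun p : ℝ × Ω => τ p.1 p.2))
    (hτ_zero : ∀ ω, τ 0 ω = ω)
    (hτ_add : ∀ x y : ℝ, ∀ ω, τ (x + y) ω = τ x (τ y ω))
    (hτ_mp : ∀ x : ℝ, MeasurePreserving (τ x) P P)
    (hτ_erg : ∀ g : Ω → ℝ, Measurable g →
      (∀ x : ℝ, ∀ᵐ ω ∂P, g (τ x ω) = g ω) → ∃ c : ℝ, ∀ᵐ ω ∂P, g ω = c)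
    {F : Ω → ℝ} (hF : Measurable F) {M : ℝ} (hM : ∀ ω, |F ω| ≤ M) :
    ∀ᵐ ω ∂P, ∀ δ : ℝ, 0 < δ → ∃ C : ℝ, ∀ x : ℝ,
      |(∫ z in (0 : ℝ)..x, F (τ z ω)) - (∫ ω, F ω ∂P) * x| ≤ δ * |x| + C := by
  have key : ∀ᵐ ω ∂P, ∀ n : ℕ, ∃ C : ℝ, ∀ x : ℝ,
      |(∫ z in (0 : ℝ)..x, F (τ z ω)) - (∫ ω, F ω ∂P) * x| ≤ 1 / ((n : ℝ) + 1) * |x| + C := by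
    refine ae_all_iff.2 fun n => ?_
    have hn : (0 : ℝ) < 1 / ((n : ℝ) + 1) := by positivity
    have hfwd := ae_abs_integral_flow_sub_le_of_nonneg hτ_meas hτ_zero hτ_add hτ_mp hτ_erg hF hM hn
    have hbwd := ae_abs_integral_flow_sub_le_of_nonneg (τ := fun x => τ (-x))
      (hτ_meas.comp (measurable_fst.neg.prodMk measurable_snd)) (by simpa using hτ_zero)
      (fun x y ω => by rw [neg_add]; exact hτ_add _ _ _) (fun x => hτ_mp (-x))
      (fun g hg h => hτ_erg g hg fun x => by simpa using h (-x)) hF hM hn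
    filter_upwards [hfwd, hbwd] with ω ⟨C₁, hC₁⟩ ⟨C₂, hC₂⟩
    refine ⟨max C₁ C₂, fun x => ?_⟩
    rcases le_total 0 x with hx | hx
    · rw [abs_of_nonneg hx]
      linarith [hC₁ x hx, le_max_left C₁ C₂]
    · have h1 := hC₂ (-x) (neg_nonneg.2 hx)
      rw [intervalIntegral.integral_comp_neg (fun z => F (τ z ω)), neg_neg, neg_zero,
        intervalIntegral.integral_symm, ← abs_neg] at h1
      rw [abs_of_nonpos hx]
      have e1 : -(-(∫ z in (0 : ℝ)..x, F (τ z ω)) - (∫ ω, F ω ∂P) * -x)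
          = (∫ z in (0 : ℝ)..x, F (τ z ω)) - (∫ ω, F ω ∂P) * x := by ring
      rw [e1] at h1
      linarith [le_max_right C₁ C₂]
  filter_upwards [key] with ω hω δ hδ
  obtain ⟨n, hn⟩ := exists_nat_one_div_lt hδ
  obtain ⟨C, hC⟩ := hω n
  refine ⟨C, fun x => (hC x).trans ?_⟩
  gcongr

lemma MemGclass.continuous {G : ℝ → ℝ} (hG : MemGclass G) : Continuous G := by
  obtain ⟨α₀, α₁, γ, -, -, -, -, h⟩ := hG
  refine continuous_iff_continuousAt.2 fun p => ?_
  rw [ContinuousAt, tendsto_iff_norm_sub_tendsto_zero]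
  have hlim : Filter.Tendsto (fun q => α₁ * (|q| + |p| + 1) ^ (γ - 1) * |q - p|) (nhds p)
      (nhds 0) := by
    have hc : ContinuousAt (fun q => α₁ * (|q| + |p| + 1) ^ (γ - 1) * |q - p|) p := by
      have h1 : ContinuousAt (fun q : ℝ => (|q| + |p| + 1) ^ (γ - 1)) p :=
        ContinuousAt.rpow_const (by fun_prop) (Or.inl (by positivity))
      have h2 : ContinuousAt (fun q : ℝ => |q - p|) p := by fun_prop
      exact (h1.const_mul α₁).mul h2
    simpa using hc.tendsto
  exact squeeze_zero (fun q => norm_nonneg _) (fun q => h q p) hlim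

lemma abs_sub_le_of_lipschitzOnWith_prod {w : ℝ → ℝ → ℝ} {K : NNReal} {s : Set ℝ}
    (h : LipschitzOnWith K (fun p : ℝ × ℝ => w p.1 p.2) (s ×ˢ univ)) {t t' : ℝ}
    (ht : t ∈ s) (ht' : t' ∈ s) (x x' : ℝ) :
    |w t x - w t' x'| ≤ K * (|t - t'| + |x - x'|) := by
  have := h.dist_le_mul (t, x) ⟨ht, mem_univ _⟩ (t', x') ⟨ht', mem_univ _⟩
  rw [Prod.dist_eq] at this
  simp only [Real.dist_eq] at this
  refine this.trans (mul_le_mul_of_nonneg_left ?_ K.coe_nonneg)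
  exact max_le (by linarith [abs_nonneg (x - x')]) (by linarith [abs_nonneg (t - t')])

lemma LipschitzWith.abs_sub_le {g : ℝ → ℝ} {K : NNReal} (h : LipschitzWith K g) (x y : ℝ) :
    |g x - g y| ≤ K * |x - y| := by
  simpa only [Real.dist_eq] using h.dist_le_mul x y

lemma tendsto_div_atTop_of_abs_sub_le {g : ℝ → ℝ} {l : ℝ}
    (h : ∀ ε : ℝ, 0 < ε → ∃ C, ∀ t, 0 < t → |g t - l * t| ≤ ε * t + C) :
    Filter.Tendsto (fun t => g t / t) Filter.atTop (nhds l) := by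
  rw [Metric.tendsto_atTop]
  intro ε hε
  obtain ⟨C, hC⟩ := h (ε / 2) (by positivity)
  refine ⟨2 * |C| / ε + 1, fun t ht => ?_⟩
  have h0 : 0 < t := lt_of_lt_of_le (by positivity) ht
  have h1 : 2 * |C| < ε * t := by
    have : 2 * |C| / ε < t := by linarith
    rw [div_lt_iff₀ hε] at this
    linarith
  have e1 : g t / t - l = (g t - l * t) / t := by field_simp
  rw [Real.dist_eq, e1, abs_div, abs_of_pos h0, div_lt_iff₀ h0]
  linarith [hC t h0, le_abs_self C]

/-- Deterministic comparison: a Lipschitz stationary corrector with sublinear deviation from its mean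
slope determines the linear growth in time of the solution of the evolution problem. -/
lemma abs_sub_le_of_corrector {a V G u : ℝ → ℝ} {w : ℝ → ℝ → ℝ} {κ β lam θ : ℝ} {K L : NNReal}
    (ha : ∀ x, a x ∈ Icc (0 : ℝ) 1) (hκ : 0 ≤ κ)
    (ha_lip : LipschitzWith (Real.toNNReal κ) (fun x => √(a x)))
    (hV_lip : LipschitzWith (Real.toNNReal κ) V) (hβ : 0 ≤ β) (hG : Continuous G)
    (hu : LipschitzWith L u) (husol : IsViscSol a V G β lam u)
    (hw : LipschitzOnWith K (fun p : ℝ × ℝ => w p.1 p.2) (Ici 0 ×ˢ univ))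
    (hwsol : IsParabolicViscSol a V G β w) (hw0 : ∀ x, w 0 x = θ * x)
    (hgrow : ∀ δ : ℝ, 0 < δ → ∃ C, ∀ x, |u x - θ * x| ≤ δ * |x| + C)
    {ε : ℝ} (hε : 0 < ε) : ∃ C, ∀ T, 0 < T → |w T 0 - lam * T| ≤ ε * T + C := by
  obtain ⟨-, hwsub, hwsup⟩ := hwsol
  obtain ⟨-, husub, husup⟩ := husol
  have hs0 : ∀ x, 0 ≤ √(a x) := fun x => Real.sqrt_nonneg _
  have hs1 : ∀ x, √(a x) ≤ 1 := fun x => Real.sqrt_le_one.2 (ha x).2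
  have hs2 : ∀ x, √(a x) ^ 2 = a x := fun x => Real.sq_sqrt (ha x).1
  have hs : ∀ x y, |√(a x) - √(a y)| ≤ κ * |x - y| := fun x y => by
    simpa only [Real.coe_toNNReal _ hκ] using ha_lip.abs_sub_le x y
  have hb : ∀ x y, |β * V x - β * V y| ≤ β * κ * |x - y| := fun x y => by
    rw [← mul_sub, abs_mul, abs_of_nonneg hβ, mul_assoc]
    gcongr
    simpa only [Real.coe_toNNReal _ hκ] using hV_lip.abs_sub_le x y
  have hwK : ∀ t t' x x', 0 ≤ t → 0 ≤ t' → |w t x - w t' x'| ≤ K * (|t - t'| + |x - x'|) :=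
    fun t t' x x' ht ht' => abs_sub_le_of_lipschitzOnWith_prod hw ht ht' x x'
  obtain ⟨C₁, hC₁⟩ := subsolution_le_of_corrector (s := fun x => √(a x)) (b := fun x => β * V x)
    (G := G) (u := u) (w := w) (lam := lam) (θ := θ) hs0 hs1 hκ hs (mul_nonneg hβ hκ) hb hG
    L.coe_nonneg hu.abs_sub_le
    (fun x₀ φ hφ h => by
      simp only [hs2]
      exact husup x₀ φ hφ h)
    K.coe_nonneg hwK
    (fun t₀ x₀ ht₀ ξ χ hξ hχ h => by
      have := hwsub t₀ x₀ ht₀ (fun p => ξ p.1 + χ p.2) (by fun_prop) h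
      simpa [hs2] using this)
    hw0
    (fun δ hδ => by
      obtain ⟨C, hC⟩ := hgrow δ hδ
      exact ⟨C, fun x => by linarith [(abs_le.1 (hC x)).1]⟩)
    hε
  obtain ⟨C₂, hC₂⟩ := subsolution_le_of_corrector (s := fun x => √(a x)) (b := fun x => -(β * V x))
    (G := fun p => -G (-p)) (u := fun x => -u x) (w := fun t x => -w t x) (lam := -lam) (θ := -θ)
    hs0 hs1 hκ hs (mul_nonneg hβ hκ)
    (fun x y => by simpa [neg_add_eq_sub, abs_sub_comm] using hb x y)
    (by fun_prop) L.coe_nonneg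
    (fun x y => by simpa [neg_add_eq_sub, abs_sub_comm] using hu.abs_sub_le x y)
    (fun x₀ φ hφ h => by
      have h' : IsLocalMax (fun x => u x - (-φ x)) x₀ := by
        filter_upwards [h] with x hx
        linarith
      have := husub x₀ (fun x => -φ x) hφ.neg h'
      simp only [deriv.fun_neg', deriv.fun_neg] at this
      simp only [hs2]
      linarith)
    K.coe_nonneg
    (fun t t' x x' ht ht' => by
      simpa [neg_add_eq_sub, abs_sub_comm] using hwK t t' x x' ht ht')
    (fun t₀ x₀ ht₀ ξ χ hξ hχ h => by
      have h' : IsLocalMin (fun p : ℝ × ℝ => w p.1 p.2 - (-ξ p.1 + -χ p.2)) (t₀, x₀) := by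
        filter_upwards [h] with p hp
        linarith
      have := hwsup t₀ x₀ ht₀ (fun p => -ξ p.1 + -χ p.2) (by fun_prop) h'
      simp [deriv.fun_neg'] at this
      simp only [hs2]
      linarith)
    (fun x => by rw [hw0]; ring)
    (fun δ hδ => by
      obtain ⟨C, hC⟩ := hgrow δ hδ
      exact ⟨C, fun x => by linarith [(abs_le.1 (hC x)).2]⟩)
    hε
  refine ⟨max C₁ C₂, fun T hT => abs_le.2 ⟨?_, ?_⟩⟩
  · linarith [hC₂ T hT, le_max_right C₁ C₂]
  · linarith [hC₁ T hT, le_max_left C₁ C₂]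

theorem corrector_implies_effective_value
    {Ω : Type*} [MeasurableSpace Ω] (P : Measure Ω) [IsProbabilityMeasure P]
    (τ : ℝ → Ω → Ω)
    (hτ_meas : Measurable (fun p : ℝ × Ω => τ p.1 p.2))
    (hτ_zero : ∀ ω, τ 0 ω = ω)
    (hτ_add : ∀ x y : ℝ, ∀ ω, τ (x + y) ω = τ x (τ y ω))
    (hτ_mp : ∀ x : ℝ, MeasurePreserving (τ x) P P)
    (hτ_erg : ∀ g : Ω → ℝ, Measurable g →
      (∀ x : ℝ, ∀ᵐ ω ∂P, g (τ x ω) = g ω) → ∃ c : ℝ, ∀ᵐ ω ∂P, g ω = c)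
    (a V : ℝ → Ω → ℝ) (κ : ℝ) (hκ : 0 < κ)
    (ha_meas : Measurable (fun p : ℝ × Ω => a p.1 p.2))
    (hV_meas : Measurable (fun p : ℝ × Ω => V p.1 p.2))
    (ha_range : ∀ x ω, a x ω ∈ Set.Icc (0 : ℝ) 1)
    (hV_range : ∀ x ω, V x ω ∈ Set.Icc (0 : ℝ) 1)
    (ha_lip : ∀ ω, LipschitzWith (Real.toNNReal κ) (fun x => Real.sqrt (a x ω)))
    (hV_lip : ∀ ω, LipschitzWith (Real.toNNReal κ) (fun x => V x ω))
    (ha_stat : ∀ x ω, a x ω = a 0 (τ x ω))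
    (hV_stat : ∀ x ω, V x ω = V 0 (τ x ω))
    (β : ℝ) (hβ : 0 ≤ β)
    (G : ℝ → ℝ) (hG : MemGclass G)
    (lam : ℝ)
    (u f : ℝ → Ω → ℝ)
    (hu_meas : Measurable (fun p : ℝ × Ω => u p.1 p.2))
    (hf_meas : Measurable (fun p : ℝ × Ω => f p.1 p.2))
    (hf_stat : ∀ x ω, f x ω = f 0 (τ x ω))
    (hf_bdd : ∃ M : ℝ, ∀ ω, |f 0 ω| ≤ M)
    (huf : ∀ x ω, u x ω = u 0 ω + ∫ z in (0 : ℝ)..x, f z ω)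
    (hu_sol : ∀ ω, (∃ K : NNReal, LipschitzWith K (fun x => u x ω)) ∧
      IsViscSol (fun x => a x ω) (fun x => V x ω) G β lam (fun x => u x ω))
    (θ : ℝ) (hθ : θ = ∫ ω, f 0 ω ∂P) :
    ∃ Ωhat : Set Ω, MeasurableSet Ωhat ∧ P Ωhat = 1 ∧
      ∀ ω ∈ Ωhat, ∀ uθ : ℝ → ℝ → ℝ,
        (∃ K : NNReal, LipschitzOnWith K (fun p : ℝ × ℝ => uθ p.1 p.2)
          (Set.Ici 0 ×ˢ Set.univ)) →
        IsParabolicViscSol (fun x => a x ω) (fun x => V x ω) G β uθ →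
        (∀ x : ℝ, uθ 0 x = θ * x) →
        Filter.Tendsto (fun t => uθ t 0 / t) Filter.atTop (nhds lam) := by
  obtain ⟨M, hM⟩ := hf_bdd
  have hF : Measurable (f 0) := hf_meas.comp (measurable_const.prodMk measurable_id)
  have hae := ae_abs_integral_flow_sub_le hτ_meas hτ_zero hτ_add hτ_mp hτ_erg hF hM
  obtain ⟨N, hN_sub, hN_meas, hN_null⟩ := exists_measurable_superset_of_null hae
  refine ⟨Nᶜ, hN_meas.compl, (prob_compl_eq_one_iff hN_meas).2 hN_null, ?_⟩
  intro ω hω uθ ⟨K, hK⟩ hsol huθ0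
  have hgood := not_not.1 fun h => hω (hN_sub h)
  obtain ⟨⟨L, hL⟩, husol⟩ := hu_sol ω
  refine tendsto_div_atTop_of_abs_sub_le fun ε hε =>
    abs_sub_le_of_corrector (fun x => ha_range x ω) hκ.le (ha_lip ω) (hV_lip ω) hβ hG.continuous
      hL husol hK hsol huθ0 (fun δ hδ => ?_) hε
  obtain ⟨C, hC⟩ := hgood δ hδ
  refine ⟨C + |u 0 ω|, fun x => ?_⟩
  have h1 := hC x
  rw [← hθ] at h1
  simp only [← hf_stat] at h1
  rw [huf x ω, add_sub_assoc]
  linarith [abs_add_le (u 0 ω) ((∫ z in (0 : ℝ)..x, f z ω) - θ * x)]
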